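/- Let G = (V, E) be a simple undirected graph with |V| = n ≥ 2, let V₁ ⊆ V be a nonempty subset, and let k be a real constant with 0 ≤ k ≤ 1. Let X be the random subset of V₁ consisting of the elements obtained by drawing ⌈3·|V₁|^k·log n⌉ samples independently and uniformly at random (with replacement) from V₁. Then with probability at least 1 − 1/n, the set X is k-good for (G, V₁), i.e., for every subset Y ⊆ V one has Σ_{w∈V₁} |Δ_G(X, Y, w)| ≤ |Y|²·|V₁|^{1−k}. -/

import Mathlib

open Finset
open scoped Classical

/-- `pairsOf S` is 𝓔(S), the set of unordered pairs of distinct elements of `S`. -/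
def pairsOf {V : Type*} [DecidableEq V] (S : Finset V) : Finset (Sym2 V) :=
  S.sym2.filter (fun e => ¬ e.IsDiag)

/-- `Δ_G(X, Y) = 𝓔(Y) \ ⋃_{u ∈ X} 𝓔(N_G(u))`. -/
def triDelta {V : Type*} [Fintype V] [DecidableEq V] (G : SimpleGraph V) [DecidableRel G.Adj]
    (X Y : Finset V) : Finset (Sym2 V) :=
  pairsOf Y \ X.biUnion (fun u => pairsOf (G.neighborFinset u))

/-- `Δ_G(X, Y, w)`: the pairs of `Δ_G(X, Y)` both of whose members are adjacent to `w`. -/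
noncomputable def triDeltaW {V : Type*} [Fintype V] [DecidableEq V] (G : SimpleGraph V)
    [DecidableRel G.Adj] (X Y : Finset V) (w : V) : Finset (Sym2 V) :=
  (triDelta G X Y).filter (fun e => ∀ v ∈ e, G.Adj v w)

/-- `X ⊆ V₁` is `k`-good for `(G, V₁)` if
`Σ_{w ∈ V₁} |Δ_G(X, Y, w)| ≤ |Y|² · |V₁|^{1−k}` for every `Y ⊆ V`. -/
def kGood {V : Type*} [Fintype V] [DecidableEq V] (G : SimpleGraph V) [DecidableRel G.Adj]
    (V₁ : Finset V) (k : ℝ) (X : Finset V) : Prop :=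
  ∀ Y : Finset V,
    (∑ w ∈ V₁, ((triDeltaW G X Y w).card : ℝ)) ≤ (Y.card : ℝ) ^ 2 * (V₁.card : ℝ) ^ ((1 : ℝ) - k)

/-- The vertices of `V₁` adjacent to both members of the pair `e`. -/
noncomputable def commonNeighborsIn {V : Type*} (G : SimpleGraph V) (V₁ : Finset V)
    (e : Sym2 V) : Finset V :=
  V₁.filter (fun w => ∀ v ∈ e, G.Adj v w)

lemma mem_commonNeighborsIn {V : Type*} {G : SimpleGraph V} {V₁ : Finset V} {e : Sym2 V} {w : V} :
    w ∈ commonNeighborsIn G V₁ e ↔ w ∈ V₁ ∧ ∀ v ∈ e, G.Adj v w := by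
  simp [commonNeighborsIn]

lemma commonNeighborsIn_subset {V : Type*} (G : SimpleGraph V) (V₁ : Finset V) (e : Sym2 V) :
    commonNeighborsIn G V₁ e ⊆ V₁ :=
  fun _ hw => (mem_commonNeighborsIn.1 hw).1

lemma mem_pairsOf {V : Type*} [DecidableEq V] {S : Finset V} {e : Sym2 V} :
    e ∈ pairsOf S ↔ (∀ v ∈ e, v ∈ S) ∧ ¬ e.IsDiag := by
  simp [pairsOf, Finset.mem_sym2_iff]

lemma choose_succ_two_le_sq (a : ℕ) : (a + 1).choose 2 ≤ a ^ 2 := by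
  rw [Nat.choose_two_right, Nat.add_sub_cancel]
  apply Nat.div_le_of_le_mul
  rcases Nat.eq_zero_or_pos a with rfl | ha
  · simp
  · nlinarith

lemma card_pairsOf_le {V : Type*} [DecidableEq V] (S : Finset V) :
    (pairsOf S).card ≤ S.card ^ 2 := by
  refine (Finset.card_filter_le _ _).trans ?_
  rw [Finset.card_sym2]
  exact choose_succ_two_le_sq _

/-- Double counting: summing `|Δ_G(X, Y, w)|` over `w` counts common neighbors of pairs. -/
lemma sum_card_triDeltaW {V : Type*} [Fintype V] [DecidableEq V] (G : SimpleGraph V)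
    [DecidableRel G.Adj] (V₁ X Y : Finset V) :
    ∑ w ∈ V₁, (triDeltaW G X Y w).card
      = ∑ e ∈ triDelta G X Y, (commonNeighborsIn G V₁ e).card := by
  simp only [triDeltaW, commonNeighborsIn, Finset.card_filter]
  rw [Finset.sum_comm]
  congr! 3

/-- A set meeting the common neighborhood of every pair with at least `|V₁|^{1-k}` common
neighbors is `k`-good. -/
lemma kGood_of_hits {V : Type*} [Fintype V] [DecidableEq V] (G : SimpleGraph V)
    [DecidableRel G.Adj] (V₁ : Finset V) (k : ℝ) (X : Finset V)
    (hX : ∀ e : Sym2 V, (V₁.card : ℝ) ^ (1 - k) ≤ ((commonNeighborsIn G V₁ e).card : ℝ) →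
      ∃ x ∈ X, x ∈ commonNeighborsIn G V₁ e) :
    kGood G V₁ k X := by
  intro Y
  have hpow : (0 : ℝ) ≤ (V₁.card : ℝ) ^ (1 - k) := by positivity
  have hlight : ∀ e ∈ triDelta G X Y,
      ((commonNeighborsIn G V₁ e).card : ℝ) ≤ (V₁.card : ℝ) ^ (1 - k) := by
    intro e he
    by_contra! hlt
    obtain ⟨x, hxX, hx⟩ := hX e hlt.le
    rw [triDelta, Finset.mem_sdiff] at he
    refine he.2 (Finset.mem_biUnion.2 ⟨x, hxX, mem_pairsOf.2 ⟨fun v hv => ?_, ?_⟩⟩)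
    · rw [SimpleGraph.mem_neighborFinset]
      exact ((mem_commonNeighborsIn.1 hx).2 v hv).symm
    · exact (mem_pairsOf.1 he.1).2
  have hcard : ((triDelta G X Y).card : ℝ) ≤ (Y.card : ℝ) ^ 2 := by
    exact_mod_cast (Finset.card_le_card Finset.sdiff_subset).trans (card_pairsOf_le Y)
  calc (∑ w ∈ V₁, ((triDeltaW G X Y w).card : ℝ))
      = ∑ e ∈ triDelta G X Y, ((commonNeighborsIn G V₁ e).card : ℝ) := by
        exact_mod_cast sum_card_triDeltaW G V₁ X Y
    _ ≤ (triDelta G X Y).card • (V₁.card : ℝ) ^ (1 - k) := Finset.sum_le_card_nsmul _ _ _ hlight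
    _ ≤ (Y.card : ℝ) ^ 2 * (V₁.card : ℝ) ^ (1 - k) := by
        rw [nsmul_eq_mul]
        gcongr

/-- The number of `s`-tuples from `A` that avoid `B ⊆ A`. -/
lemma card_tuples_avoiding {α : Type*} [DecidableEq α] {A B : Finset α} (hBA : B ⊆ A) (s : ℕ) :
    ((Finset.univ.filter (fun f : Fin s → {x // x ∈ A} => ∀ i, (f i : α) ∉ B)).card : ℝ)
      = ((A.card : ℝ) - B.card) ^ s := by
  have hpi : (Finset.univ.filter (fun f : Fin s → {x // x ∈ A} => ∀ i, (f i : α) ∉ B))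
      = Fintype.piFinset (fun _ => Finset.univ.filter (fun x : {x // x ∈ A} => (x : α) ∉ B)) := by
    ext f
    simp [Fintype.mem_piFinset]
  have hone : (Finset.univ.filter (fun x : {x // x ∈ A} => (x : α) ∉ B)).card
      = (A \ B).card := by
    rw [← Finset.card_map (Function.Embedding.subtype _)]
    congr 1
    ext x
    simp
    tauto
  rw [hpi, Fintype.card_piFinset_const, hone, Finset.card_sdiff_of_subset hBA, Nat.cast_pow,
    Nat.cast_sub (Finset.card_le_card hBA)]

/-- With `s ≥ 3·m^k·log n` draws from `m` elements, a set of size `c ≥ m^{1-k}` is missed with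
probability at most `n⁻³`. -/
lemma sub_pow_le_of_log_le {m c n k : ℝ} {s : ℕ} (hm : 0 < m) (hn : 0 < n) (hcm : c ≤ m)
    (hc : m ^ (1 - k) ≤ c) (hs : 3 * m ^ k * Real.log n ≤ s) :
    (m - c) ^ s ≤ m ^ s / n ^ 3 := by
  have hmk : 0 < m ^ k := Real.rpow_pos_of_pos hm k
  have hratio : (m ^ k)⁻¹ ≤ c / m := by
    rw [le_div_iff₀ hm]
    rwa [Real.rpow_sub hm, Real.rpow_one, div_eq_inv_mul] at hc
  have hlog : 3 * Real.log n ≤ (c / m) * s := by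
    calc 3 * Real.log n = (m ^ k)⁻¹ * (3 * m ^ k * Real.log n) := by field_simp
      _ ≤ (m ^ k)⁻¹ * s := by gcongr
      _ ≤ (c / m) * s := by gcongr
  have hbase : m - c ≤ m * Real.exp (-(c / m)) := by
    calc m - c = m * (-(c / m) + 1) := by field_simp; ring
      _ ≤ m * Real.exp (-(c / m)) := by
        gcongr
        exact Real.add_one_le_exp _
  calc (m - c) ^ s ≤ (m * Real.exp (-(c / m))) ^ s := pow_le_pow_left₀ (by linarith) hbase s
    _ = m ^ s * Real.exp (-((c / m) * s)) := by
        rw [mul_pow, ← Real.exp_nat_mul]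
        congr 2
        ring
    _ ≤ m ^ s * Real.exp (-(3 * Real.log n)) := by gcongr
    _ = m ^ s / n ^ 3 := by
        rw [Real.exp_neg, ← div_eq_mul_inv]
        congr 1
        rw [show (3 : ℝ) * Real.log n = (3 : ℕ) * Real.log n by norm_num, Real.exp_nat_mul,
          Real.exp_log hn]

/-- Drawing `⌈3·|V₁|^k·log n⌉` independent uniform samples (with replacement) from `V₁`,
the resulting set `X` is `k`-good for `(G, V₁)` with probability at least `1 − 1/n`:
stated by counting the sample tuples whose image is `k`-good. -/
theorem sampled_set_is_kGood_whp {V : Type*} [Fintype V] [DecidableEq V]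
    (G : SimpleGraph V) [DecidableRel G.Adj]
    (V₁ : Finset V) (hV₁ : V₁.Nonempty)
    (k : ℝ) (hk0 : 0 ≤ k) (hk1 : k ≤ 1)
    (n : ℕ) (hn : n = Fintype.card V) (hn2 : 2 ≤ n)
    (s : ℕ) (hs : s = ⌈3 * (V₁.card : ℝ) ^ k * Real.log n⌉₊) :
    (1 - 1 / (n : ℝ)) * ((V₁.card : ℝ) ^ s) ≤
      (((Finset.univ : Finset (Fin s → {x // x ∈ V₁})).filter
        (fun f => kGood G V₁ k (Finset.image (fun i => (f i : V)) Finset.univ))).card : ℝ) := by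
  have hm : (0 : ℝ) < V₁.card := by exact_mod_cast hV₁.card_pos
  have hnpos : (0 : ℝ) < n := by exact_mod_cast (by omega : 0 < n)
  have hs' : 3 * (V₁.card : ℝ) ^ k * Real.log n ≤ s := hs ▸ Nat.le_ceil _
  set good := (Finset.univ : Finset (Fin s → {x // x ∈ V₁})).filter
    (fun f => kGood G V₁ k (Finset.image (fun i => (f i : V)) Finset.univ))
  set heavy := (Finset.univ : Finset (Sym2 V)).filter
    (fun e => (V₁.card : ℝ) ^ (1 - k) ≤ ((commonNeighborsIn G V₁ e).card : ℝ))
  set missing : Sym2 V → Finset (Fin s → {x // x ∈ V₁}) := fun e =>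
    Finset.univ.filter (fun f => ∀ i, (f i : V) ∉ commonNeighborsIn G V₁ e) with hmissing
  have hcover : (Finset.univ : Finset (Fin s → {x // x ∈ V₁})) ⊆ good ∪ heavy.biUnion missing := by
    intro f _
    by_contra hf
    simp only [Finset.mem_union, Finset.mem_biUnion, not_or, not_exists, not_and] at hf
    refine hf.1 (Finset.mem_filter.2 ⟨Finset.mem_univ _, kGood_of_hits G V₁ k _ fun e he => ?_⟩)
    have hfe := hf.2 e (Finset.mem_filter.2 ⟨Finset.mem_univ _, he⟩)
    simp only [hmissing, Finset.mem_filter, Finset.mem_univ, true_and, not_forall, not_not] at hfe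
    obtain ⟨i, hi⟩ := hfe
    exact ⟨f i, Finset.mem_image_of_mem _ (Finset.mem_univ i), hi⟩
  have htotal : ((Finset.univ : Finset (Fin s → {x // x ∈ V₁})).card : ℝ)
      = (V₁.card : ℝ) ^ s := by
    simp
  have hmiss : ∀ e ∈ heavy, ((missing e).card : ℝ) ≤ (V₁.card : ℝ) ^ s / (n : ℝ) ^ 3 := by
    intro e he
    have hsub : commonNeighborsIn G V₁ e ⊆ V₁ := commonNeighborsIn_subset G V₁ e
    simp only [hmissing]
    rw [card_tuples_avoiding hsub]
    exact sub_pow_le_of_log_le hm hnpos (by exact_mod_cast Finset.card_le_card hsub)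
      (Finset.mem_filter.1 he).2 hs'
  have hheavy_card : (heavy.card : ℝ) ≤ (n : ℝ) ^ 2 := by
    have hle : heavy.card ≤ n ^ 2 := by
      refine (Finset.card_le_univ _).trans ?_
      rw [Sym2.card, ← hn]
      exact choose_succ_two_le_sq n
    exact_mod_cast hle
  have hbad : ((heavy.biUnion missing).card : ℝ) ≤ 1 / (n : ℝ) * (V₁.card : ℝ) ^ s := by
    calc ((heavy.biUnion missing).card : ℝ) ≤ ∑ e ∈ heavy, ((missing e).card : ℝ) := by
          exact_mod_cast Finset.card_biUnion_le
      _ ≤ heavy.card • ((V₁.card : ℝ) ^ s / (n : ℝ) ^ 3) := Finset.sum_le_card_nsmul _ _ _ hmiss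
      _ ≤ (n : ℝ) ^ 2 * ((V₁.card : ℝ) ^ s / (n : ℝ) ^ 3) := by
          rw [nsmul_eq_mul]
          gcongr
      _ = 1 / (n : ℝ) * (V₁.card : ℝ) ^ s := by field_simp
  have hsum : (V₁.card : ℝ) ^ s ≤ good.card + (heavy.biUnion missing).card := by
    rw [← htotal]
    exact_mod_cast (Finset.card_le_card hcover).trans (Finset.card_union_le _ _)
  linarith
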